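/- arXiv:2001.03262 — 2 statements merged into one kernel-verified Lean document; each statement's English description precedes it below -/
import Mathlib

section
/- Let f ∈ ℝ[x₁,…,xₙ] be a circuit polynomial, f(x) = Σ_{j=0}^r f_{α(j)} x^{α(j)} + f_{α*} x^{α*} with r ≤ n, and let λ_f denote the unique map of minimal barycentric coordinates of f. Then f is coercive on ℝⁿ if and only if one of the following holds: (a) r = n and f fulfills conditions (C1), (C2) and (C3); or (b) r = n−1 and f fulfills conditions (C1), (C2) and (C3) together with f_{α*} > −Θ(f,λ_f,α*) if α* ∈ (2ℕ₀)ⁿ, and |f_{α*}| < Θ(f,λ_f,α*) if α* ∉ (2ℕ₀)ⁿ. -/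
open MvPolynomial Filter

noncomputable section

open scoped Classical

/-- The embedding of exponent vectors into `ℝⁿ`. -/
def expEmbed {n : ℕ} (α : Fin n →₀ ℕ) : Fin n → ℝ := fun i => (α i : ℝ)

/-- The Newton polytope at infinity `New∞(f) = conv(A(f) ∪ {0})`. -/
def newtonInfty {n : ℕ} (f : MvPolynomial (Fin n) ℝ) : Set (Fin n → ℝ) :=
  convexHull ℝ (expEmbed '' ((insert 0 f.support : Finset (Fin n →₀ ℕ)) : Set (Fin n →₀ ℕ)))

/-- The vertex set `V₀(f)` of the Newton polytope at infinity, as a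
finset of exponent vectors. -/
def V0 {n : ℕ} (f : MvPolynomial (Fin n) ℝ) : Finset (Fin n →₀ ℕ) :=
  (insert 0 f.support).filter fun α => expEmbed α ∈ Set.extremePoints ℝ (newtonInfty f)

/-- The set `V(f) = V₀(f) \ {0}` of vertices at infinity. -/
def Vinf {n : ℕ} (f : MvPolynomial (Fin n) ℝ) : Finset (Fin n →₀ ℕ) := (V0 f).erase 0

/-- An exponent vector with all entries even, i.e. a member of `(2ℕ₀)ⁿ`. -/
def IsEvenExp {n : ℕ} (α : Fin n →₀ ℕ) : Prop := ∀ i, Even (α i)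

/-- Condition (C1): `V(f) ⊆ (2ℕ₀)ⁿ`. -/
def CondC1 {n : ℕ} (f : MvPolynomial (Fin n) ℝ) : Prop := ∀ α ∈ Vinf f, IsEvenExp α

/-- Condition (C2): positive coefficients at all vertices at infinity. -/
def CondC2 {n : ℕ} (f : MvPolynomial (Fin n) ℝ) : Prop := ∀ α ∈ Vinf f, 0 < f.coeff α

/-- Condition (C3): `V(f)` contains a vector `2 kᵢ eᵢ` for every `i`. -/
def CondC3 {n : ℕ} (f : MvPolynomial (Fin n) ℝ) : Prop :=
  ∀ i : Fin n, ∃ k : ℕ, 0 < k ∧ Finsupp.single i (2 * k) ∈ Vinf f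

/-- An exponent vector of `f` is gem degenerate if it is no vertex at infinity but lies in
some nonempty face of `New∞(f)` not containing the origin. -/
def IsGemDegenerate {n : ℕ} (f : MvPolynomial (Fin n) ℝ) (α : Fin n →₀ ℕ) : Prop :=
  α ∈ f.support ∧ α ∉ Vinf f ∧
    ∃ G : Set (Fin n → ℝ), G.Nonempty ∧ IsExtreme ℝ (newtonInfty f) G ∧
      (0 : Fin n → ℝ) ∉ G ∧ expEmbed α ∈ G

/-- The set `D(f)` of gem degenerate exponent vectors of `f`. -/
def Dfin {n : ℕ} (f : MvPolynomial (Fin n) ℝ) : Finset (Fin n →₀ ℕ) :=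
  f.support.filter fun α => IsGemDegenerate f α

/-- `f` is gem regular if `D(f) = ∅`. -/
def GemRegular {n : ℕ} (f : MvPolynomial (Fin n) ℝ) : Prop := ∀ α, ¬ IsGemDegenerate f α

/-- `V₀ᶜ(f) = A(f) \ V₀(f)`. -/
def V0c {n : ℕ} (f : MvPolynomial (Fin n) ℝ) : Finset (Fin n →₀ ℕ) := f.support \ V0 f

/-- A map of minimal barycentric coordinates of `f`. -/
def IsMinBary {n : ℕ} (f : MvPolynomial (Fin n) ℝ)
    (lam : (Fin n →₀ ℕ) → (Fin n →₀ ℕ) → ℝ) : Prop :=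
  (∀ αs α, 0 ≤ lam αs α ∧ lam αs α ≤ 1) ∧
  ∀ αs ∈ V0c f, ∃ W : Finset (Fin n →₀ ℕ), W ⊆ V0 f ∧
    AffineIndependent ℝ (fun w : W => expEmbed (w : Fin n →₀ ℕ)) ∧
    (∀ α ∈ W, 0 < lam αs α) ∧
    (∀ α ∈ V0 f, α ∉ W → lam αs α = 0) ∧
    (∑ α ∈ W, lam αs α) = 1 ∧
    (∑ α ∈ W, lam αs α • expEmbed α) = expEmbed αs

/-- `W_{α*}(λ_f)`, the minimal vertex representation of `α*` corresponding to `λ_f`. -/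
def Wfin {n : ℕ} (f : MvPolynomial (Fin n) ℝ)
    (lam : (Fin n →₀ ℕ) → (Fin n →₀ ℕ) → ℝ) (αs : Fin n →₀ ℕ) : Finset (Fin n →₀ ℕ) :=
  (V0 f).filter fun α => 0 < lam αs α

/-- The circuit number `Θ(f, λ_f, α*)`. -/
def circuitNumber {n : ℕ} (f : MvPolynomial (Fin n) ℝ)
    (lam : (Fin n →₀ ℕ) → (Fin n →₀ ℕ) → ℝ) (αs : Fin n →₀ ℕ) : ℝ :=
  ∏ α ∈ Wfin f lam αs, (f.coeff α / lam αs α) ^ (lam αs α)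

/-- `g` is coercive on `ℝⁿ`: `g(x) → +∞` whenever `‖x‖ → +∞`. -/
def Coercive {n : ℕ} (g : (Fin n → ℝ) → ℝ) : Prop :=
  Tendsto g (comap (fun x : Fin n → ℝ => ‖x‖) atTop) atTop


/-- The polynomial `Σ_{j=0}^r c_j x^{α(j)} + c* x^{α*}`. -/
noncomputable def circuitPoly {n r : ℕ} (α : Fin (r + 1) → (Fin n →₀ ℕ)) (c : Fin (r + 1) → ℝ)
    (αs : Fin n →₀ ℕ) (cs : ℝ) : MvPolynomial (Fin n) ℝ :=
  (∑ j, MvPolynomial.monomial (α j) (c j)) + MvPolynomial.monomial αs cs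

/-- The data `(α, c, α*, c*, λ)` describes a circuit polynomial
`f = Σ_{j=0}^r c_j x^{α(j)} + c* x^{α*}` with `r ≤ n`. -/
def IsCircuit {n r : ℕ} (α : Fin (r + 1) → (Fin n →₀ ℕ)) (c : Fin (r + 1) → ℝ)
    (αs : Fin n →₀ ℕ) (cs : ℝ) (lam : Fin (r + 1) → ℝ) : Prop :=
  r ≤ n ∧
  αs ∉ Set.range α ∧
  (∀ j, IsEvenExp (α j)) ∧
  (∀ j, 0 < c j) ∧
  Set.extremePoints ℝ
      (convexHull ℝ (expEmbed '' ((circuitPoly α c αs cs).support : Set (Fin n →₀ ℕ))))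
    = expEmbed '' Set.range α ∧
  AffineIndependent ℝ (fun j => expEmbed (α j)) ∧
  (∀ j, 0 < lam j) ∧ (∑ j, lam j) = 1 ∧ (∑ j, lam j • expEmbed (α j)) = expEmbed αs

/-- The circuit number `Θ = Π_{j=0}^r (c_j / λ_j)^{λ_j}` of a circuit polynomial. -/
noncomputable def circuitTheta {r : ℕ} (c : Fin (r + 1) → ℝ) (lam : Fin (r + 1) → ℝ) : ℝ :=
  ∏ j, (c j / lam j) ^ (lam j)

/-- The monomial `∏ i, |xᵢ| ^ βᵢ` in the absolute values of the coordinates. -/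
def absMonomial {n : ℕ} (x : Fin n → ℝ) (β : Fin n →₀ ℕ) : ℝ := ∏ i, |x i| ^ β i

theorem absMonomial_nonneg {n : ℕ} (x : Fin n → ℝ) (β : Fin n →₀ ℕ) : 0 ≤ absMonomial x β :=
  Finset.prod_nonneg fun _ _ => pow_nonneg (abs_nonneg _) _

theorem absMonomial_single {n : ℕ} (x : Fin n → ℝ) (i : Fin n) (m : ℕ) :
    absMonomial x (Finsupp.single i m) = |x i| ^ m := by
  unfold absMonomial
  rw [Finset.prod_eq_single i]
  · simp
  · intro k _ hk
    simp [Finsupp.single_eq_of_ne hk]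
  · simp

theorem prod_absMonomial_rpow {n : ℕ} {ι : Type*} [Fintype ι] (x : Fin n → ℝ)
    (a : ι → (Fin n →₀ ℕ)) (w : ι → ℝ) (hw : ∀ j, 0 ≤ w j) (β : Fin n →₀ ℕ)
    (h : ∀ i, ∑ j, w j * (a j i : ℝ) = β i) :
    ∏ j, absMonomial x (a j) ^ w j = absMonomial x β := by
  unfold absMonomial
  have h1 : ∀ j, (∏ i, |x i| ^ a j i) ^ w j = ∏ i, |x i| ^ (w j * (a j i : ℝ)) := by
    intro j
    rw [← Real.finsetProd_rpow _ _ fun i _ => pow_nonneg (abs_nonneg _) _]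
    refine Finset.prod_congr rfl fun i _ => ?_
    rw [mul_comm, Real.rpow_mul (abs_nonneg _), Real.rpow_natCast]
  simp_rw [h1]
  rw [Finset.prod_comm]
  refine Finset.prod_congr rfl fun i _ => ?_
  rw [← Real.rpow_sum_of_nonneg (abs_nonneg _) fun j _ => mul_nonneg (hw j) (Nat.cast_nonneg _),
    h i, Real.rpow_natCast]

theorem eval_monomial_eq_prod {n : ℕ} (x : Fin n → ℝ) (β : Fin n →₀ ℕ) (b : ℝ) :
    eval x (monomial β b) = b * ∏ i, x i ^ β i := by
  rw [eval_monomial, Finsupp.prod_fintype _ _ (fun i => pow_zero _)]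

theorem abs_prod_pow {n : ℕ} (x : Fin n → ℝ) (β : Fin n →₀ ℕ) :
    |∏ i, x i ^ β i| = absMonomial x β := by
  simp [absMonomial, Finset.abs_prod, abs_pow]

theorem IsEvenExp.prod_pow_eq {n : ℕ} {β : Fin n →₀ ℕ} (hβ : IsEvenExp β) (x : Fin n → ℝ) :
    ∏ i, x i ^ β i = absMonomial x β :=
  Finset.prod_congr rfl fun i _ => ((hβ i).pow_abs (x i)).symm

theorem eval_circuitPoly {n r : ℕ} (α : Fin (r + 1) → (Fin n →₀ ℕ)) (c : Fin (r + 1) → ℝ)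
    (αs : Fin n →₀ ℕ) (cs : ℝ) (hα : ∀ j, IsEvenExp (α j)) (x : Fin n → ℝ) :
    eval x (circuitPoly α c αs cs) =
      ∑ j, c j * absMonomial x (α j) + cs * ∏ i, x i ^ αs i := by
  unfold circuitPoly
  rw [map_add, map_sum, eval_monomial_eq_prod]
  congr 1
  exact Finset.sum_congr rfl fun j _ => by rw [eval_monomial_eq_prod, (hα j).prod_pow_eq]

theorem coercive_iff {n : ℕ} (g : (Fin n → ℝ) → ℝ) :
    Coercive g ↔ ∀ B : ℝ, ∃ R : ℝ, ∀ x, R ≤ ‖x‖ → B ≤ g x := by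
  unfold Coercive
  rw [tendsto_atTop]
  refine forall_congr' fun B => ?_
  rw [eventually_comap, eventually_atTop]
  constructor
  · rintro ⟨R, h⟩
    exact ⟨R, fun x hx => h _ hx x rfl⟩
  · rintro ⟨R, h⟩
    exact ⟨R, fun b hb x hx => h x (hx ▸ hb)⟩

theorem mem_extremePoints_convexHull_of_lt {E : Type*} [AddCommGroup E] [Module ℝ E]
    {S : Set E} {p : E} (hp : p ∈ S) (φ : E →ₗ[ℝ] ℝ) (h : ∀ s ∈ S, s ≠ p → φ s < φ p) :
    p ∈ Set.extremePoints ℝ (convexHull ℝ S) := by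
  have hconv : Convex ℝ {x | x = p ∨ φ x < φ p} := by
    rw [convex_iff_forall_pos]
    rintro x hx y hy a b ha hb hab
    rcases hx with rfl | hx
    · rcases hy with rfl | hy
      · left
        rw [← add_smul, hab, one_smul]
      · right
        simp only [map_add, map_smul, smul_eq_mul]
        have : a = 1 - b := by linarith
        subst this
        nlinarith
    · right
      have hy' : φ y ≤ φ p := by
        rcases hy with rfl | hy
        · exact le_rfl
        · exact hy.le
      simp only [map_add, map_smul, smul_eq_mul]
      have : a = 1 - b := by linarith
      subst this
      nlinarith
  have hsub : convexHull ℝ S ⊆ {x | x = p ∨ φ x < φ p} :=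
    convexHull_min (fun s hs => (eq_or_ne s p).imp id (h s hs)) hconv
  rw [mem_extremePoints_iff_left]
  refine ⟨subset_convexHull ℝ S hp, fun x hx y hy hxy => ?_⟩
  rcases hsub hx with hx | hx
  · exact hx
  · exfalso
    have hy' : φ y ≤ φ p := by
      rcases hsub hy with rfl | hy
      · exact le_rfl
      · exact hy.le
    obtain ⟨a, b, ha, hb, hab, hEq⟩ := hxy
    have := congrArg φ hEq
    simp only [map_add, map_smul, smul_eq_mul] at this
    have hb' : a = 1 - b := by linarith
    subst hb'
    nlinarith

theorem coeff_circuitPoly {n r : ℕ} {α : Fin (r + 1) → (Fin n →₀ ℕ)} {c : Fin (r + 1) → ℝ}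
    {αs : Fin n →₀ ℕ} {cs : ℝ} (hinj : Function.Injective α) (hαs : αs ∉ Set.range α)
    (j : Fin (r + 1)) : coeff (α j) (circuitPoly α c αs cs) = c j := by
  have h : αs ≠ α j := fun h => hαs ⟨j, h.symm⟩
  unfold circuitPoly
  rw [coeff_add, coeff_sum, coeff_monomial, if_neg h, add_zero, Finset.sum_eq_single j]
  · simp
  · intro k _ hk
    rw [coeff_monomial, if_neg fun h => hk (hinj h)]
  · simp

theorem support_circuitPoly_subset {n r : ℕ} (α : Fin (r + 1) → (Fin n →₀ ℕ))
    (c : Fin (r + 1) → ℝ) (αs : Fin n →₀ ℕ) (cs : ℝ) {β : Fin n →₀ ℕ}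
    (h : β ∈ (circuitPoly α c αs cs).support) : (∃ j, α j = β) ∨ αs = β := by
  by_contra! hβ
  rw [mem_support_iff] at h
  apply h
  unfold circuitPoly
  rw [coeff_add, coeff_sum, coeff_monomial, if_neg hβ.2, add_zero]
  exact Finset.sum_eq_zero fun j _ => by rw [coeff_monomial, if_neg (hβ.1 j)]

theorem expEmbed_injective {n : ℕ} : Function.Injective (expEmbed (n := n)) := by
  intro a b h
  ext i
  exact Nat.cast_injective (R := ℝ) (congrFun h i)

namespace IsCircuit

variable {n r : ℕ} {α : Fin (r + 1) → (Fin n →₀ ℕ)} {c : Fin (r + 1) → ℝ}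
  {αs : Fin n →₀ ℕ} {cs : ℝ} {lam : Fin (r + 1) → ℝ}

theorem le (h : IsCircuit α c αs cs lam) : r ≤ n := h.1

theorem notMem_range (h : IsCircuit α c αs cs lam) : αs ∉ Set.range α := h.2.1

theorem even (h : IsCircuit α c αs cs lam) : ∀ j, IsEvenExp (α j) := h.2.2.1

theorem coeff_pos (h : IsCircuit α c αs cs lam) : ∀ j, 0 < c j := h.2.2.2.1

theorem affineIndependent (h : IsCircuit α c αs cs lam) :
    AffineIndependent ℝ (fun j => expEmbed (α j)) := h.2.2.2.2.2.1

theorem lam_pos (h : IsCircuit α c αs cs lam) : ∀ j, 0 < lam j := h.2.2.2.2.2.2.1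

theorem sum_lam (h : IsCircuit α c αs cs lam) : ∑ j, lam j = 1 := h.2.2.2.2.2.2.2.1

theorem sum_smul (h : IsCircuit α c αs cs lam) : ∑ j, lam j • expEmbed (α j) = expEmbed αs :=
  h.2.2.2.2.2.2.2.2

theorem injective (h : IsCircuit α c αs cs lam) : Function.Injective α := fun _ _ hab =>
  h.affineIndependent.injective (congrArg expEmbed hab)

theorem sum_mul (h : IsCircuit α c αs cs lam) (i : Fin n) :
    ∑ j, lam j * (α j i : ℝ) = αs i := by
  have := congrFun h.sum_smul i
  simpa [expEmbed, Finset.sum_apply] using this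

theorem apply_eq_zero (h : IsCircuit α c αs cs lam) {k : Fin n} (hk : αs k = 0)
    (j : Fin (r + 1)) : α j k = 0 := by
  have h1 := h.sum_mul k
  rw [hk, Nat.cast_zero, Finset.sum_eq_zero_iff_of_nonneg
    fun j _ => mul_nonneg (h.lam_pos j).le (Nat.cast_nonneg _)] at h1
  have h2 := (mul_eq_zero.1 (h1 j (Finset.mem_univ _))).resolve_left (h.lam_pos j).ne'
  exact_mod_cast h2

theorem mem_support (h : IsCircuit α c αs cs lam) (j : Fin (r + 1)) :
    α j ∈ (circuitPoly α c αs cs).support := by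
  rw [mem_support_iff, coeff_circuitPoly h.injective h.notMem_range]
  exact (h.coeff_pos j).ne'

theorem mem_range_of_mem_Vinf (h : IsCircuit α c αs cs lam) {β : Fin n →₀ ℕ}
    (hβ : β ∈ Vinf (circuitPoly α c αs cs)) : ∃ j, α j = β := by
  unfold Vinf V0 at hβ
  rw [Finset.mem_erase, Finset.mem_filter, Finset.mem_insert] at hβ
  obtain ⟨h0, hmem, hext⟩ := hβ
  rcases support_circuitPoly_subset _ _ _ _ (hmem.resolve_left h0) with hj | rfl
  · exact hj
  · exfalso
    have hconv := (convex_convexHull ℝ _).mem_extremePoints_iff_convex_sdiff.1 hext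
    have hsum := hconv.2.sum_mem (t := Finset.univ) (w := lam) (z := fun j => expEmbed (α j))
      (fun j _ => (h.lam_pos j).le) h.sum_lam (fun j _ => by
        refine ⟨subset_convexHull ℝ _ ⟨α j, ?_, rfl⟩, fun hj => ?_⟩
        · rw [Finset.mem_coe, Finset.mem_insert]
          exact Or.inr (h.mem_support j)
        · exact h.notMem_range ⟨j, expEmbed_injective hj⟩)
    rw [h.sum_smul] at hsum
    exact hsum.2 rfl

theorem condC1 (h : IsCircuit α c αs cs lam) : CondC1 (circuitPoly α c αs cs) := by
  intro β hβ
  obtain ⟨j, rfl⟩ := h.mem_range_of_mem_Vinf hβ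
  exact h.even j

theorem condC2 (h : IsCircuit α c αs cs lam) : CondC2 (circuitPoly α c αs cs) := by
  intro β hβ
  obtain ⟨j, rfl⟩ := h.mem_range_of_mem_Vinf hβ
  rw [coeff_circuitPoly h.injective h.notMem_range]
  exact h.coeff_pos j

theorem exists_eq_single_of_condC3 (h : IsCircuit α c αs cs lam)
    (h3 : CondC3 (circuitPoly α c αs cs)) :
    ∃ (σ : Fin n → Fin (r + 1)) (k : Fin n → ℕ), Function.Injective σ ∧ (∀ i, 0 < k i) ∧
      ∀ i, α (σ i) = Finsupp.single i (2 * k i) := by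
  choose k hk hmem using h3
  choose σ hσ using fun i => h.mem_range_of_mem_Vinf (hmem i)
  refine ⟨σ, k, fun a b hab => ?_, hk, hσ⟩
  have h1 := (hσ a).symm.trans ((congrArg α hab).trans (hσ b))
  by_contra hne
  have h2 := DFunLike.congr_fun h1 a
  rw [Finsupp.single_eq_same, Finsupp.single_eq_of_ne hne] at h2
  have := hk a
  omega

/-- On the axis of a coordinate `i` there is an exponent `α j ≠ 0` when the circuit polynomial is
coercive. -/
theorem exists_eq_single_of_coercive (h : IsCircuit α c αs cs lam)
    (hco : Coercive fun x => eval x (circuitPoly α c αs cs)) (i : Fin n) :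
    ∃ j, (∀ k, k ≠ i → α j k = 0) ∧ 0 < α j i := by
  by_contra! hno
  have hs : (∀ k, k ≠ i → αs k = 0) → αs i = 0 := by
    intro hk
    have hα : ∀ j k, k ≠ i → α j k = 0 := fun j k hki => h.apply_eq_zero (hk k hki) j
    have h1 := h.sum_mul i
    rw [Finset.sum_eq_zero fun j _ => by
      rw [Nat.le_zero.1 (hno j (hα j)), Nat.cast_zero, mul_zero]] at h1
    exact_mod_cast h1.symm
  have key : ∀ (β : Fin n →₀ ℕ) (t : ℝ), ((∀ k, k ≠ i → β k = 0) → β i = 0) →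
      ∏ k, (Pi.single i t : Fin n → ℝ) k ^ β k = ∏ k, (0 : Fin n → ℝ) k ^ β k := by
    intro β t hβ
    by_cases hk : ∀ k, k ≠ i → β k = 0
    · refine Finset.prod_congr rfl fun k _ => ?_
      by_cases hki : k = i
      · subst hki
        rw [hβ hk, pow_zero, pow_zero]
      · rw [hk k hki, pow_zero, pow_zero]
    · push Not at hk
      obtain ⟨k, hki, hk⟩ := hk
      rw [Finset.prod_eq_zero (Finset.mem_univ k), Finset.prod_eq_zero (Finset.mem_univ k)]
      · simp [hk]
      · simp [hki, hk]
  have hconst : ∀ t : ℝ, eval (Pi.single i t : Fin n → ℝ) (circuitPoly α c αs cs) =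
      eval 0 (circuitPoly α c αs cs) := by
    intro t
    unfold circuitPoly
    simp only [map_add, map_sum, eval_monomial_eq_prod]
    rw [key αs t hs]
    congr 1
    exact Finset.sum_congr rfl fun j _ => by
      rw [key (α j) t fun hj => Nat.le_zero.1 (hno j hj)]
  obtain ⟨R, hR⟩ := (coercive_iff _).1 hco (eval 0 (circuitPoly α c αs cs) + 1)
  have h1 := hR (Pi.single i R) (by rw [Pi.norm_single]; exact le_abs_self R)
  rw [hconst] at h1
  linarith

theorem condC3_of_coercive (h : IsCircuit α c αs cs lam)
    (hco : Coercive fun x => eval x (circuitPoly α c αs cs)) :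
    CondC3 (circuitPoly α c αs cs) := by
  intro i
  obtain ⟨j₀, hj₀, hpos₀⟩ := h.exists_eq_single_of_coercive hco i
  obtain ⟨j, hj, hmax⟩ := Finset.exists_max_image
    (Finset.univ.filter fun j => ∀ k, k ≠ i → α j k = 0) (fun j => α j i)
    ⟨j₀, Finset.mem_filter.2 ⟨Finset.mem_univ _, hj₀⟩⟩
  replace hj := (Finset.mem_filter.1 hj).2
  replace hmax : ∀ j', (∀ k, k ≠ i → α j' k = 0) → α j' i ≤ α j i := fun j' hj' =>
    hmax j' (Finset.mem_filter.2 ⟨Finset.mem_univ _, hj'⟩)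
  have hpos : 0 < α j i := hpos₀.trans_le (hmax j₀ hj₀)
  obtain ⟨k, hk⟩ := even_iff_exists_two_mul.1 (h.even j i)
  have hsingle : α j = Finsupp.single i (2 * k) := by
    ext l
    by_cases hl : l = i
    · subst hl
      rw [Finsupp.single_eq_same, hk]
    · rw [hj l hl, Finsupp.single_eq_of_ne hl]
  refine ⟨k, by omega, ?_⟩
  rw [← hsingle]
  have hne : α j ≠ 0 := fun h0 => by simp [h0] at hpos
  unfold Vinf V0
  rw [Finset.mem_erase, Finset.mem_filter, Finset.mem_insert]
  refine ⟨hne, Or.inr (h.mem_support j), ?_⟩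
  have hs : (∀ k, k ≠ i → αs k = 0) → αs i < α j i := by
    intro hk
    have hα : ∀ j k, k ≠ i → α j k = 0 := fun j k hki => h.apply_eq_zero (hk k hki) j
    have hle : (αs i : ℝ) ≤ α j i := by
      rw [← h.sum_mul i]
      calc ∑ j', lam j' * (α j' i : ℝ) ≤ ∑ j', lam j' * (α j i : ℝ) :=
            Finset.sum_le_sum fun j' _ => mul_le_mul_of_nonneg_left
              (Nat.cast_le.2 (hmax j' (hα j'))) (h.lam_pos j').le
        _ = α j i := by rw [← Finset.sum_mul, h.sum_lam, one_mul]
    refine lt_of_le_of_ne (Nat.cast_le.1 hle) fun heq => h.notMem_range ⟨j, ?_⟩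
    ext l
    by_cases hl : l = i
    · subst hl
      exact heq.symm
    · rw [hj l hl, hk l hl]
  set M : ℝ := ∑ β ∈ insert 0 (circuitPoly α c αs cs).support, (β i : ℝ) with hM
  let φ : (Fin n → ℝ) →ₗ[ℝ] ℝ :=
    LinearMap.proj i - M • ∑ l ∈ Finset.univ.erase i, LinearMap.proj l
  have hφ : ∀ β : Fin n →₀ ℕ,
      φ (expEmbed β) = β i - M * ∑ l ∈ Finset.univ.erase i, (β l : ℝ) := by
    intro β
    simp [φ, expEmbed, LinearMap.sum_apply]
  have hφj : φ (expEmbed (α j)) = α j i := by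
    rw [hφ, Finset.sum_eq_zero fun l hl => by rw [hj l (Finset.ne_of_mem_erase hl), Nat.cast_zero],
      mul_zero, sub_zero]
  refine mem_extremePoints_convexHull_of_lt
    ⟨α j, Finset.mem_coe.2 (Finset.mem_insert_of_mem (h.mem_support j)), rfl⟩ φ ?_
  rintro _ ⟨β, hβ, rfl⟩ hβne
  have hβj : β ≠ α j := fun he => hβne (congrArg _ he)
  rw [hφj, hφ]
  by_cases hax : ∀ l, l ≠ i → β l = 0
  · rw [Finset.sum_eq_zero fun l hl => by rw [hax l (Finset.ne_of_mem_erase hl), Nat.cast_zero],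
      mul_zero, sub_zero, Nat.cast_lt]
    rcases Finset.mem_insert.1 (Finset.mem_coe.1 hβ) with rfl | hβ
    · exact hpos
    · rcases support_circuitPoly_subset _ _ _ _ hβ with ⟨j', rfl⟩ | rfl
      · refine lt_of_le_of_ne (hmax j' hax) fun heq => hβj ?_
        ext l
        by_cases hl : l = i
        · subst hl
          exact heq
        · rw [hj l hl, hax l hl]
      · exact hs hax
  · push Not at hax
    obtain ⟨l, hl, hl0⟩ := hax
    have h1 : (β i : ℝ) ≤ M := Finset.single_le_sum (f := fun β : Fin n →₀ ℕ => (β i : ℝ))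
      (fun _ _ => Nat.cast_nonneg _) (Finset.mem_coe.1 hβ)
    have h2 : (1 : ℝ) ≤ ∑ l ∈ Finset.univ.erase i, (β l : ℝ) := by
      refine le_trans ?_ (Finset.single_le_sum (f := fun l => (β l : ℝ))
        (fun _ _ => Nat.cast_nonneg _) (Finset.mem_erase.2 ⟨hl, Finset.mem_univ l⟩))
      exact_mod_cast Nat.one_le_iff_ne_zero.2 hl0
    have h3 : (0 : ℝ) ≤ M := (Nat.cast_nonneg _).trans h1
    have h4 : (0 : ℝ) < α j i := by exact_mod_cast hpos
    nlinarith

theorem coercive_sum_absMonomial (h : IsCircuit α c αs cs lam)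
    (h3 : CondC3 (circuitPoly α c αs cs)) :
    Coercive fun x => ∑ j, c j * absMonomial x (α j) := by
  obtain ⟨σ, k, -, hk, hσ⟩ := h.exists_eq_single_of_condC3 h3
  obtain ⟨j₀, -, hj₀⟩ := Finset.exists_min_image Finset.univ c Finset.univ_nonempty
  rw [coercive_iff]
  intro B
  refine ⟨max 1 (B / c j₀), fun x hx => ?_⟩
  have hx1 : 1 ≤ ‖x‖ := (le_max_left _ _).trans hx
  have hne : Nonempty (Fin n) := by
    by_contra hempty
    rw [not_nonempty_iff] at hempty
    rw [Subsingleton.elim x 0, norm_zero] at hx1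
    linarith
  obtain ⟨i, hi⟩ : ∃ i, ‖x‖ = |x i| := by
    obtain ⟨i, -, hi⟩ := Finset.exists_max_image Finset.univ (fun i => |x i|)
      Finset.univ_nonempty
    refine ⟨i, le_antisymm ?_ (norm_le_pi_norm x i)⟩
    exact (pi_norm_le_iff_of_nonneg (abs_nonneg _)).2 fun l => hi l (Finset.mem_univ _)
  have h1 : B ≤ c j₀ * ‖x‖ := by
    have := (div_le_iff₀ (h.coeff_pos j₀)).1 ((le_max_right _ _).trans hx)
    linarith
  have h2 : ‖x‖ ≤ absMonomial x (α (σ i)) := by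
    rw [hσ, absMonomial_single, ← hi]
    exact le_self_pow₀ hx1 (by have := hk i; omega)
  calc B ≤ c j₀ * ‖x‖ := h1
    _ ≤ c (σ i) * absMonomial x (α (σ i)) :=
        mul_le_mul (hj₀ _ (Finset.mem_univ _)) h2 (norm_nonneg _) (h.coeff_pos _).le
    _ ≤ ∑ j, c j * absMonomial x (α j) :=
        Finset.single_le_sum (f := fun j => c j * absMonomial x (α j))
          (fun j _ => mul_nonneg (h.coeff_pos j).le (absMonomial_nonneg _ _))
          (Finset.mem_univ _)

theorem circuitTheta_pos (h : IsCircuit α c αs cs lam) : 0 < circuitTheta c lam :=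
  Finset.prod_pos fun j _ => Real.rpow_pos_of_pos (div_pos (h.coeff_pos j) (h.lam_pos j)) _

theorem circuitTheta_mul_absMonomial_le (h : IsCircuit α c αs cs lam) (x : Fin n → ℝ) :
    circuitTheta c lam * absMonomial x αs ≤ ∑ j, c j * absMonomial x (α j) := by
  have hamgm := Real.geom_mean_le_arith_mean_weighted Finset.univ lam
    (fun j => c j / lam j * absMonomial x (α j)) (fun j _ => (h.lam_pos j).le) h.sum_lam
    (fun j _ => mul_nonneg (div_pos (h.coeff_pos j) (h.lam_pos j)).le (absMonomial_nonneg _ _))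
  have h1 : ∏ j, (c j / lam j * absMonomial x (α j)) ^ lam j =
      circuitTheta c lam * absMonomial x αs := by
    rw [← prod_absMonomial_rpow x α lam (fun j => (h.lam_pos j).le) αs h.sum_mul]
    unfold circuitTheta
    rw [← Finset.prod_mul_distrib]
    exact Finset.prod_congr rfl fun j _ =>
      Real.mul_rpow (div_pos (h.coeff_pos j) (h.lam_pos j)).le (absMonomial_nonneg _ _)
  rw [h1] at hamgm
  refine hamgm.trans_eq (Finset.sum_congr rfl fun j _ => ?_)
  have := (h.lam_pos j).ne'
  field_simp

theorem coercive_of_lt_circuitTheta (h : IsCircuit α c αs cs lam)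
    (h3 : CondC3 (circuitPoly α c αs cs)) (heven : IsEvenExp αs → cs > -circuitTheta c lam)
    (hodd : ¬ IsEvenExp αs → |cs| < circuitTheta c lam) :
    Coercive fun x => eval x (circuitPoly α c αs cs) := by
  have hΘ := h.circuitTheta_pos
  obtain ⟨m, hm0, hmΘ, hm⟩ : ∃ m : ℝ, 0 ≤ m ∧ m < circuitTheta c lam ∧
      ∀ x : Fin n → ℝ, -(m * absMonomial x αs) ≤ cs * ∏ i, x i ^ αs i := by
    by_cases he : IsEvenExp αs
    · refine ⟨max 0 (-cs), le_max_left _ _, max_lt hΘ (by linarith [heven he]), fun x => ?_⟩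
      rw [he.prod_pow_eq]
      nlinarith [le_max_right 0 (-cs), absMonomial_nonneg x αs]
    · refine ⟨|cs|, abs_nonneg _, hodd he, fun x => ?_⟩
      rw [← abs_prod_pow, ← abs_mul]
      exact neg_abs_le _
  have hδ : 0 < 1 - m / circuitTheta c lam := by
    rw [sub_pos, div_lt_one hΘ]
    exact hmΘ
  refine tendsto_atTop_mono (fun x => ?_)
    (Tendsto.const_mul_atTop hδ (h.coercive_sum_absMonomial h3))
  rw [eval_circuitPoly _ _ _ _ h.even]
  have h1 := mul_le_mul_of_nonneg_left (h.circuitTheta_mul_absMonomial_le x)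
    (div_nonneg hm0 hΘ.le)
  rw [← mul_assoc, div_mul_cancel₀ _ hΘ.ne'] at h1
  linarith [hm x]

/-- If `r = n`, the inner exponent is a combination of the outer ones with positive weights of
total mass less than one. -/
theorem exists_weights (h : IsCircuit α c αs cs lam) (hr : r = n) :
    ∃ w : Fin (r + 1) → ℝ, (∀ j, 0 < w j) ∧ ∑ j, w j < 1 ∧
      ∀ i, ∑ j, w j * (α j i : ℝ) = αs i := by
  have htop : affineSpan ℝ (Set.range fun j => expEmbed (α j)) = ⊤ := by
    rw [h.affineIndependent.affineSpan_eq_top_iff_card_eq_finrank_add_one]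
    simp [hr]
  obtain ⟨v, hv1, hv0⟩ := eq_affineCombination_of_mem_affineSpan_of_fintype
    (p1 := (0 : Fin n → ℝ)) (htop ▸ AffineSubspace.mem_top ℝ (Fin n → ℝ) 0)
  rw [Finset.affineCombination_eq_linear_combination _ _ _ hv1] at hv0
  have hv : ∀ i, ∑ j, v j * (α j i : ℝ) = 0 := by
    intro i
    have := (congrFun hv0 i).symm
    simpa [expEmbed, Finset.sum_apply] using this
  have hev : ∀ᶠ ε : ℝ in nhdsWithin 0 (Set.Ioi 0), ∀ j, 0 < lam j - ε * v j := by
    rw [eventually_all]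
    intro j
    refine eventually_nhdsWithin_of_eventually_nhds ?_
    have hc : Continuous fun ε : ℝ => lam j - ε * v j := by fun_prop
    exact hc.continuousAt.eventually (lt_mem_nhds (by simpa using h.lam_pos j))
  obtain ⟨ε, hε, hε0⟩ := (hev.and self_mem_nhdsWithin).exists
  refine ⟨fun j => lam j - ε * v j, hε, ?_, fun i => ?_⟩
  · rw [Finset.sum_sub_distrib, ← Finset.mul_sum, h.sum_lam, hv1]
    have : (0 : ℝ) < ε := hε0
    linarith
  · simp_rw [sub_mul, mul_assoc]
    rw [Finset.sum_sub_distrib, ← Finset.mul_sum, h.sum_mul, hv, mul_zero, sub_zero]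

theorem coercive_of_eq (h : IsCircuit α c αs cs lam) (hr : r = n)
    (h3 : CondC3 (circuitPoly α c αs cs)) :
    Coercive fun x => eval x (circuitPoly α c αs cs) := by
  obtain ⟨w, hw, hw1, hwα⟩ := h.exists_weights hr
  set p := ∑ j, w j with hp
  have hp0 : 0 < p := Finset.sum_pos (fun j _ => hw j) Finset.univ_nonempty
  set K := |cs| * ∏ j, (c j)⁻¹ ^ w j with hK
  have hlim : Tendsto (fun s : ℝ => s ^ p * (s ^ (1 - p) - K)) atTop atTop :=
    (tendsto_rpow_atTop hp0).atTop_mul_atTop₀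
      (tendsto_atTop_add_const_right _ (-K) (tendsto_rpow_atTop (sub_pos.2 hw1)))
  refine tendsto_atTop_mono (fun x => ?_) (hlim.comp (h.coercive_sum_absMonomial h3))
  rw [eval_circuitPoly _ _ _ _ h.even, Function.comp_apply]
  have hterm : ∀ j, 0 ≤ c j * absMonomial x (α j) := fun j =>
    mul_nonneg (h.coeff_pos j).le (absMonomial_nonneg _ _)
  set S := ∑ j, c j * absMonomial x (α j) with hS
  have hS0 : 0 ≤ S := Finset.sum_nonneg fun j _ => hterm j
  have hbound : absMonomial x αs ≤ (∏ j, (c j)⁻¹ ^ w j) * S ^ p := by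
    rw [← prod_absMonomial_rpow x α w (fun j => (hw j).le) αs hwα, hp,
      Real.rpow_sum_of_nonneg hS0 fun j _ => (hw j).le, ← Finset.prod_mul_distrib]
    refine Finset.prod_le_prod (fun j _ => Real.rpow_nonneg (absMonomial_nonneg _ _) _)
      fun j _ => ?_
    rw [← Real.mul_rpow (inv_pos.2 (h.coeff_pos j)).le hS0]
    refine Real.rpow_le_rpow (absMonomial_nonneg _ _) ?_ (hw j).le
    rw [inv_mul_eq_div, le_div_iff₀ (h.coeff_pos j), mul_comm]
    exact Finset.single_le_sum (f := fun j => c j * absMonomial x (α j))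
      (fun j _ => hterm j) (Finset.mem_univ j)
  have h1 : -(|cs| * absMonomial x αs) ≤ cs * ∏ i, x i ^ αs i := by
    rw [← abs_prod_pow, ← abs_mul]
    exact neg_abs_le _
  have h2 : S ^ p * S ^ (1 - p) = S := by
    rw [← Real.rpow_add_of_nonneg hS0 hp0.le (sub_pos.2 hw1).le, add_sub_cancel, Real.rpow_one]
  have h4 := mul_le_mul_of_nonneg_left hbound (abs_nonneg cs)
  rw [mul_sub, h2, hK]
  linarith

theorem not_coercive_of_signs (h : IsCircuit α c αs cs lam) (hr : r + 1 = n)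
    (h3 : CondC3 (circuitPoly α c αs cs)) (s : Fin n → ℝ) (hs : ∀ i, |s i| = 1)
    (hcs : cs * ∏ i, s i ^ αs i ≤ -circuitTheta c lam) :
    ¬ Coercive fun x => eval x (circuitPoly α c αs cs) := by
  intro hco
  obtain ⟨σ, k, hinj, hk, hσ⟩ := h.exists_eq_single_of_condC3 h3
  have hsurj : Function.Surjective σ :=
    ((Fintype.bijective_iff_injective_and_card σ).2 ⟨hinj, by simp [hr]⟩).2
  have hΘ := h.circuitTheta_pos
  obtain ⟨R, hR⟩ := (coercive_iff _).1 hco 1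
  obtain ⟨i₀⟩ : Nonempty (Fin n) := ⟨⟨0, by omega⟩⟩
  set R' := max R 1 with hR'
  have hR'0 : 0 < R' := lt_max_of_lt_right one_pos
  set t := c (σ i₀) / lam (σ i₀) * R' ^ (2 * k i₀) with ht
  have ht0 : 0 < t :=
    mul_pos (div_pos (h.coeff_pos _) (h.lam_pos _)) (pow_pos hR'0 _)
  have hq0 : ∀ j, 0 < lam j / c j * t := fun j =>
    mul_pos (div_pos (h.lam_pos j) (h.coeff_pos j)) ht0
  obtain ⟨u, hu0, hu⟩ : ∃ u : Fin n → ℝ, (∀ i, 0 ≤ u i) ∧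
      ∀ i, u i ^ (2 * k i) = lam (σ i) / c (σ i) * t :=
    ⟨fun i => (lam (σ i) / c (σ i) * t) ^ ((2 * k i : ℕ) : ℝ)⁻¹,
      fun i => Real.rpow_nonneg (hq0 _).le _,
      fun i => Real.rpow_inv_natCast_pow (hq0 _).le (by have := hk i; omega)⟩
  set x : Fin n → ℝ := fun i => s i * u i with hx
  have hxabs : ∀ i, |x i| = u i := fun i => by
    rw [hx, abs_mul, hs, one_mul, abs_of_nonneg (hu0 i)]
  have hmono : ∀ j, absMonomial x (α j) = lam j / c j * t := by
    intro j
    obtain ⟨i, rfl⟩ := hsurj j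
    rw [hσ, absMonomial_single, hxabs, hu]
  have hnorm : R ≤ ‖x‖ := by
    have h1 : u i₀ ^ (2 * k i₀) = R' ^ (2 * k i₀) := by
      rw [hu, ht]
      have := (h.coeff_pos (σ i₀)).ne'
      have := (h.lam_pos (σ i₀)).ne'
      field_simp
    have h2 : u i₀ = R' :=
      (pow_left_inj₀ (hu0 _) hR'0.le (by have := hk i₀; omega)).1 h1
    calc R ≤ R' := le_max_left _ _
      _ = ‖x i₀‖ := by rw [Real.norm_eq_abs, hxabs, h2]
      _ ≤ ‖x‖ := norm_le_pi_norm x i₀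
  have hsum : ∑ j, c j * absMonomial x (α j) = t := by
    have : ∀ j, c j * absMonomial x (α j) = lam j * t := fun j => by
      rw [hmono]
      have := (h.coeff_pos j).ne'
      field_simp
    simp_rw [this]
    rw [← Finset.sum_mul, h.sum_lam, one_mul]
  have habs : circuitTheta c lam * absMonomial x αs = t := by
    rw [← prod_absMonomial_rpow x α lam (fun j => (h.lam_pos j).le) αs h.sum_mul]
    unfold circuitTheta
    rw [← Finset.prod_mul_distrib]
    have : ∀ j, (c j / lam j) ^ lam j * absMonomial x (α j) ^ lam j = t ^ lam j := by
      intro j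
      rw [← Real.mul_rpow (div_pos (h.coeff_pos j) (h.lam_pos j)).le (absMonomial_nonneg _ _),
        hmono]
      congr 1
      have := (h.coeff_pos j).ne'
      have := (h.lam_pos j).ne'
      field_simp
    simp_rw [this]
    rw [← Real.rpow_sum_of_nonneg ht0.le fun j _ => (h.lam_pos j).le, h.sum_lam, Real.rpow_one]
  have hprod : ∏ i, x i ^ αs i = (∏ i, s i ^ αs i) * absMonomial x αs := by
    unfold absMonomial
    rw [← Finset.prod_mul_distrib]
    exact Finset.prod_congr rfl fun i _ => by rw [hxabs, ← mul_pow]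
  have h1 := hR x hnorm
  rw [eval_circuitPoly _ _ _ _ h.even, hsum, hprod, ← mul_assoc] at h1
  have h2 := mul_le_mul_of_nonneg_right hcs (absMonomial_nonneg x αs)
  linarith

theorem exists_signs (cs : ℝ) {β : Fin n →₀ ℕ} (hβ : ¬ IsEvenExp β) :
    ∃ s : Fin n → ℝ, (∀ i, |s i| = 1) ∧ cs * ∏ i, s i ^ β i = -|cs| := by
  unfold IsEvenExp at hβ
  push Not at hβ
  obtain ⟨i, hi⟩ := hβ
  rcases le_total cs 0 with hcs | hcs
  · exact ⟨1, by simp, by simp [abs_of_nonpos hcs]⟩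
  · refine ⟨Function.update 1 i (-1), fun l => ?_, ?_⟩
    · by_cases hl : l = i
      · subst hl
        simp
      · simp [hl]
    · rw [Finset.prod_eq_single i]
      · simp [(Nat.not_even_iff_odd.1 hi).neg_one_pow, abs_of_nonneg hcs]
      · intro l _ hl
        simp [hl]
      · simp

end IsCircuit

/-- Theorem: coercivity characterization for circuit polynomials. -/
theorem stmt3 {n r : ℕ} (α : Fin (r + 1) → (Fin n →₀ ℕ)) (c : Fin (r + 1) → ℝ)
    (αs : Fin n →₀ ℕ) (cs : ℝ) (lam : Fin (r + 1) → ℝ)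
    (hcirc : IsCircuit α c αs cs lam) :
    (Coercive fun x => MvPolynomial.eval x (circuitPoly α c αs cs)) ↔
      ((r = n ∧ CondC1 (circuitPoly α c αs cs) ∧ CondC2 (circuitPoly α c αs cs) ∧
          CondC3 (circuitPoly α c αs cs)) ∨
        (r + 1 = n ∧ CondC1 (circuitPoly α c αs cs) ∧ CondC2 (circuitPoly α c αs cs) ∧
          CondC3 (circuitPoly α c αs cs) ∧
          (IsEvenExp αs → cs > -circuitTheta c lam) ∧
          (¬ IsEvenExp αs → |cs| < circuitTheta c lam))) := by
  constructor
  · intro hco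
    have h3 := hcirc.condC3_of_coercive hco
    have hn : n ≤ r + 1 := by
      obtain ⟨σ, -, hσ, -⟩ := hcirc.exists_eq_single_of_condC3 h3
      simpa using Fintype.card_le_of_injective σ hσ
    have hle := hcirc.le
    by_cases hr : r = n
    · exact Or.inl ⟨hr, hcirc.condC1, hcirc.condC2, h3⟩
    · have hr' : r + 1 = n := by omega
      refine Or.inr ⟨hr', hcirc.condC1, hcirc.condC2, h3, fun _ => ?_, fun hodd => ?_⟩
      · by_contra hcs
        exact hcirc.not_coercive_of_signs hr' h3 1 (by simp) (by simpa using hcs) hco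
      · by_contra hcs
        obtain ⟨s, hs, hprod⟩ := IsCircuit.exists_signs cs hodd
        exact hcirc.not_coercive_of_signs hr' h3 s hs (by linarith) hco
  · rintro (⟨hr, -, -, h3⟩ | ⟨-, -, -, h3, heven, hodd⟩)
    · exact hcirc.coercive_of_eq hr h3
    · exact hcirc.coercive_of_lt_circuitTheta h3 heven hodd

end
end

section
/- Let f ∈ ℝ[x₁,…,xₙ] be gem regular. Then f is coercive on ℝⁿ if and only if f fulfills conditions (C1), (C2) and (C3). -/
open MvPolynomial Filter

noncomputable section

open scoped Classical

section Exposed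

variable {E : Type*} [AddCommGroup E] [Module ℝ E]

/-- A point which strictly maximizes a linear functional over a generating set is an extreme
point of the convex hull. -/
theorem mem_extremePoints_convexHull_of_lt_s5 (s : Set E) (c : E →ₗ[ℝ] ℝ) {x : E} (hx : x ∈ s)
    (h : ∀ y ∈ s, y ≠ x → c y < c x) : x ∈ (convexHull ℝ s).extremePoints ℝ := by
  have hconv : Convex ℝ {y | y = x ∨ c y < c x} := by
    intro y hy z hz a b ha hb hab
    rcases ha.eq_or_lt with rfl | ha'
    · obtain rfl : b = 1 := by linarith
      simpa using hz
    rcases hb.eq_or_lt with rfl | hb'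
    · obtain rfl : a = 1 := by linarith
      simpa using hy
    rcases hy with rfl | hy
    · rcases hz with rfl | hz
      · left
        rw [← add_smul, hab, one_smul]
      · right
        simp only [map_add, map_smul, smul_eq_mul]
        obtain rfl : a = 1 - b := by linarith
        nlinarith
    · have hz' : c z ≤ c x := by
        rcases hz with rfl | hz
        exacts [le_rfl, hz.le]
      right
      simp only [map_add, map_smul, smul_eq_mul]
      obtain rfl : a = 1 - b := by linarith
      nlinarith
  have hsub : convexHull ℝ s ⊆ {y | y = x ∨ c y < c x} :=
    convexHull_min (fun y hy => (eq_or_ne y x).imp id (h y hy)) hconv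
  rw [mem_extremePoints_iff_left]
  refine ⟨subset_convexHull ℝ s hx, ?_⟩
  rintro y hy z hz ⟨a, b, ha, hb, hab, he⟩
  rcases hsub hy with rfl | hlt
  · rfl
  have hz' : c z ≤ c x := by
    rcases hsub hz with rfl | hz
    exacts [le_rfl, hz.le]
  have := congrArg c he
  simp only [map_add, map_smul, smul_eq_mul] at this
  obtain rfl : a = 1 - b := by linarith
  nlinarith

/-- The points of a convex set that are no contraction of a point of the set towards the origin
form an extreme subset. -/
theorem isExtreme_not_mem_contraction {P : Set E} (hP : Convex ℝ P) :
    IsExtreme ℝ P {x ∈ P | ∀ s : ℝ, 0 ≤ s → s < 1 → ∀ p ∈ P, x ≠ s • p} where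
  subset := fun _ hx => hx.1
  left_mem_of_mem_openSegment := by
    rintro y hy z hz x ⟨_, hx⟩ ⟨a, b, ha, hb, hab, rfl⟩
    refine ⟨hy, ?_⟩
    rintro s hs hs1 p hp rfl
    have hr : 0 < a * s + b := by positivity
    refine hx (a * s + b) hr.le (by nlinarith)
      ((a * s / (a * s + b)) • p + (b / (a * s + b)) • z)
      (hP hp hz (by positivity) (by positivity) (by field_simp)) ?_
    rw [smul_add, smul_smul, smul_smul, smul_smul, mul_div_cancel₀ _ hr.ne',
      mul_div_cancel₀ _ hr.ne']

end Exposed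

@[simp] theorem expEmbed_zero {n : ℕ} : expEmbed (0 : Fin n →₀ ℕ) = 0 := by
  ext i
  simp [expEmbed]

theorem mem_Vinf {n : ℕ} {f : MvPolynomial (Fin n) ℝ} {α : Fin n →₀ ℕ} :
    α ∈ Vinf f ↔ α ≠ 0 ∧ α ∈ f.support ∧
      expEmbed α ∈ Set.extremePoints ℝ (newtonInfty f) := by
  simp only [Vinf, V0, Finset.mem_erase, Finset.mem_filter, Finset.mem_insert]
  tauto

/-- Every vertex at infinity is exposed by a linear functional. -/
theorem exists_functional_of_mem_Vinf {n : ℕ} {f : MvPolynomial (Fin n) ℝ} {α : Fin n →₀ ℕ}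
    (hα : α ∈ Vinf f) : ∃ c : Fin n → ℝ, 0 < ∑ i, c i * α i ∧
      ∀ β ∈ f.support, β ≠ α → ∑ i, c i * β i < ∑ i, c i * α i := by
  obtain ⟨h0, -, hext⟩ := mem_Vinf.1 hα
  set F : Set (Fin n → ℝ) :=
    expEmbed '' ((insert 0 f.support : Finset (Fin n →₀ ℕ)) : Set (Fin n →₀ ℕ)) with hF
  have hFfin : F.Finite := (Finset.finite_toSet _).image _
  have hnot : expEmbed α ∉ convexHull ℝ (F \ {expEmbed α}) := by
    rw [newtonInfty, (convex_convexHull ℝ _).mem_extremePoints_iff_mem_sdiff_convexHull_sdiff]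
      at hext
    exact fun h => hext.2 (convexHull_mono (Set.sdiff_subset_sdiff_left (subset_convexHull ℝ _)) h)
  obtain ⟨g, u, hg, hu⟩ := geometric_hahn_banach_closed_point (convex_convexHull ℝ _)
    ((hFfin.subset Set.sdiff_subset).isClosed_convexHull ℝ) hnot
  have hlt : ∀ β ∈ insert 0 f.support, β ≠ α → g (expEmbed β) < g (expEmbed α) := by
    intro β hβ hne
    refine (hg _ (subset_convexHull ℝ _ ⟨⟨β, by exact_mod_cast hβ, rfl⟩, ?_⟩)).trans hu
    exact fun h => hne (expEmbed_injective h)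
  have hsum : ∀ β : Fin n →₀ ℕ,
      g (expEmbed β) = ∑ i, g (fun j => if i = j then 1 else 0) * β i := by
    intro β
    have := LinearMap.pi_apply_eq_sum_univ (g : (Fin n → ℝ) →ₗ[ℝ] ℝ) (expEmbed β)
    simpa [expEmbed, mul_comm] using this
  refine ⟨fun i => g (fun j => if i = j then 1 else 0), ?_, ?_⟩
  · rw [← hsum]
    simpa using hlt 0 (by simp) h0.symm
  · intro β hβ hne
    rw [← hsum, ← hsum]
    exact hlt β (Finset.mem_insert_of_mem hβ) hne

/-- Along a curve adapted to a vertex at infinity, the vertex monomial dominates, so coercivity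
makes the vertex term positive. -/
theorem vertex_term_pos {n : ℕ} {f : MvPolynomial (Fin n) ℝ}
    (hf : Coercive fun x => MvPolynomial.eval x f) {α : Fin n →₀ ℕ} (hα : α ∈ Vinf f)
    {y : Fin n → ℝ} (hy : ∀ i, |y i| = 1) : 0 < f.coeff α * ∏ i, y i ^ α i := by
  obtain ⟨c, hc0, hc⟩ := exists_functional_of_mem_Vinf hα
  have hαs : α ∈ f.support := (mem_Vinf.1 hα).2.1
  obtain ⟨i, hi⟩ : ∃ i, 0 < c i := by
    by_contra! h
    exact hc0.not_ge (Finset.sum_nonpos fun i _ =>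
      mul_nonpos_of_nonpos_of_nonneg (h i) (Nat.cast_nonneg _))
  let X : ℝ → Fin n → ℝ := fun t j => y j * Real.exp (c j * t)
  have hX : Tendsto X atTop (comap (fun x : Fin n → ℝ => ‖x‖) atTop) := by
    rw [tendsto_comap_iff]
    refine tendsto_atTop_mono (fun t => ?_)
      (Real.tendsto_exp_atTop.comp (tendsto_id.const_mul_atTop hi))
    refine le_trans (le_of_eq ?_) (norm_le_pi_norm (X t) i)
    simp [X, hy i]
  have hmon : ∀ (β : Fin n →₀ ℕ) (t : ℝ),
      ∏ j, X t j ^ β j = (∏ j, y j ^ β j) * Real.exp ((∑ j, c j * β j) * t) := by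
    intro β t
    simp only [X, mul_pow, Finset.prod_mul_distrib, ← Real.exp_nat_mul, ← Real.exp_sum,
      Finset.sum_mul]
    congr 2
    exact Finset.sum_congr rfl fun j _ => by ring
  have hlim : Tendsto (fun t => MvPolynomial.eval (X t) f * Real.exp (-((∑ j, c j * α j) * t)))
      atTop (nhds (∑ β ∈ f.support, if β = α then f.coeff α * ∏ j, y j ^ α j else 0)) := by
    simp only [MvPolynomial.eval_eq', hmon, Finset.sum_mul]
    refine tendsto_finsetSum _ fun β hβ => ?_
    have he : ∀ t, f.coeff β * ((∏ j, y j ^ β j) * Real.exp ((∑ j, c j * β j) * t)) *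
        Real.exp (-((∑ j, c j * α j) * t)) = f.coeff β * (∏ j, y j ^ β j) *
          Real.exp (((∑ j, c j * β j) - ∑ j, c j * α j) * t) := by
      intro t
      rw [sub_mul, sub_eq_add_neg, Real.exp_add]
      ring
    have hfun := funext he
    simp only [Finset.sum_mul] at hfun ⊢
    simp only [hfun]
    split_ifs with h
    · subst h
      simp
    · have hneg : (∑ j, c j * β j) - ∑ j, c j * α j < 0 := sub_neg.2 (hc β hβ h)
      simpa using ((Real.tendsto_exp_atBot.comp
        (tendsto_id.const_mul_atTop_of_neg hneg)).const_mul (f.coeff β * ∏ j, y j ^ β j))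
  rw [Finset.sum_ite_eq', if_pos hαs] at hlim
  have hnn : 0 ≤ f.coeff α * ∏ j, y j ^ α j := by
    refine ge_of_tendsto hlim ?_
    filter_upwards [(hf.comp hX).eventually_ge_atTop 0] with t ht
    exact mul_nonneg ht (Real.exp_pos _).le
  refine hnn.lt_of_ne' (mul_ne_zero (MvPolynomial.mem_support_iff.1 hαs) ?_)
  refine Finset.prod_ne_zero_iff.2 fun j _ => pow_ne_zero _ fun h => ?_
  simpa [h] using hy j

theorem Coercive.condC2 {n : ℕ} {f : MvPolynomial (Fin n) ℝ}
    (hf : Coercive fun x => MvPolynomial.eval x f) : CondC2 f := fun α hα => by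
  simpa using vertex_term_pos hf hα (y := fun _ => 1) (by simp)

theorem Coercive.condC1 {n : ℕ} {f : MvPolynomial (Fin n) ℝ}
    (hf : Coercive fun x => MvPolynomial.eval x f) : CondC1 f := fun α hα i => by
  have h := vertex_term_pos hf hα (y := Function.update (fun _ => 1) i (-1)) fun j => by
    rcases eq_or_ne j i with rfl | hj
    · simp
    · simp [hj]
  rw [Finset.prod_eq_single i (fun j _ hj => by simp [hj]) (by simp), Function.update_self] at h
  by_contra hodd
  rw [(Nat.not_even_iff_odd.1 hodd).neg_one_pow] at h
  linarith [hf.condC2 α hα]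

/-- If all pure powers of `X i` in `f` have exponent at most `d`, and `d` is attained, then this
pure power is a vertex at infinity. -/
theorem single_mem_Vinf {n : ℕ} {f : MvPolynomial (Fin n) ℝ} {i : Fin n} {d : ℕ} (hd : 0 < d)
    (hmem : Finsupp.single i d ∈ f.support)
    (hmax : ∀ k, Finsupp.single i k ∈ f.support → k ≤ d) : Finsupp.single i d ∈ Vinf f := by
  refine mem_Vinf.2 ⟨by simpa using hd.ne', hmem, ?_⟩
  let M : ℝ := ∑ α ∈ f.support, (α i : ℝ)
  let c : (Fin n → ℝ) →ₗ[ℝ] ℝ :=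
    LinearMap.proj i - M • ∑ j ∈ Finset.univ.erase i, LinearMap.proj j
  have hc : ∀ α : Fin n →₀ ℕ,
      c (expEmbed α) = α i - M * ∑ j ∈ Finset.univ.erase i, (α j : ℝ) := by
    intro α
    simp [c, expEmbed]
  have hcs : ∀ k : ℕ, c (expEmbed (Finsupp.single i k)) = k := by
    intro k
    rw [hc, Finset.sum_eq_zero fun j hj => by
      simp [Finsupp.single_eq_of_ne (Finset.ne_of_mem_erase hj)]]
    simp
  refine mem_extremePoints_convexHull_of_lt_s5 _ c ⟨_, by simpa using Or.inr hmem, rfl⟩ ?_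
  rintro _ ⟨α, hα, rfl⟩ hne
  have hne' : α ≠ Finsupp.single i d := fun h => hne (by rw [h])
  rw [hcs]
  rcases Finset.mem_insert.1 (Finset.mem_coe.1 hα) with rfl | hα
  · simpa using hd
  by_cases hpure : ∃ k, α = Finsupp.single i k
  · obtain ⟨k, rfl⟩ := hpure
    rw [hcs]
    have : k ≠ d := fun h => hne' (by rw [h])
    exact_mod_cast (hmax k hα).lt_of_ne this
  · obtain ⟨j, hji, hj⟩ : ∃ j, j ≠ i ∧ α j ≠ 0 := by
      by_contra! h
      refine hpure ⟨α i, Finsupp.ext fun j => ?_⟩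
      rcases eq_or_ne j i with rfl | hj
      · simp
      · rw [h j hj, Finsupp.single_eq_of_ne hj]
    have h1 : (1 : ℝ) ≤ ∑ j ∈ Finset.univ.erase i, (α j : ℝ) :=
      le_trans (by exact_mod_cast Nat.one_le_iff_ne_zero.2 hj)
        (Finset.single_le_sum (f := fun j => (α j : ℝ)) (fun _ _ => Nat.cast_nonneg _)
          (Finset.mem_erase.2 ⟨hji, Finset.mem_univ j⟩))
    have h2 : (α i : ℝ) ≤ M :=
      Finset.single_le_sum (f := fun α : Fin n →₀ ℕ => (α i : ℝ))
        (fun _ _ => Nat.cast_nonneg _) hα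
    have h3 : (0 : ℝ) ≤ α i := Nat.cast_nonneg _
    have h4 : (0 : ℝ) < d := Nat.cast_pos.2 hd
    rw [hc]
    nlinarith

theorem Coercive.condC3 {n : ℕ} {f : MvPolynomial (Fin n) ℝ}
    (hf : Coercive fun x => MvPolynomial.eval x f) : CondC3 f := fun i => by
  let A := f.support.filter fun α => α i ≠ 0 ∧ α = Finsupp.single i (α i)
  have hA : A.Nonempty := by
    by_contra hA
    have hA' : ∀ α ∈ f.support, α i ≠ 0 → α ≠ Finsupp.single i (α i) := by
      intro α hα h0 h
      exact hA ⟨α, Finset.mem_filter.2 ⟨hα, h0, h⟩⟩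
    have hX : Tendsto (fun t : ℝ => (Pi.single i t : Fin n → ℝ)) atTop
        (comap (fun x : Fin n → ℝ => ‖x‖) atTop) := by
      rw [tendsto_comap_iff]
      refine tendsto_atTop_mono (fun t => ?_) tendsto_id
      simpa using (le_abs_self t).trans
        (by simpa using norm_le_pi_norm (Pi.single i t : Fin n → ℝ) i)
    have hconst : ∀ t : ℝ, MvPolynomial.eval (Pi.single i t : Fin n → ℝ) f = f.coeff 0 := by
      intro t
      rw [MvPolynomial.eval_eq', Finset.sum_eq_single 0]
      · simp
      · intro α hα h0
        obtain ⟨j, hj, hj0⟩ : ∃ j, j ≠ i ∧ α j ≠ 0 := by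
          by_contra! h
          have hs : α = Finsupp.single i (α i) := by
            ext j
            rcases eq_or_ne j i with rfl | hj
            · simp
            · rw [h j hj, Finsupp.single_eq_of_ne hj]
          exact hA' α hα (fun h0' => h0 (by rw [hs, h0', Finsupp.single_zero])) hs
        rw [Finset.prod_eq_zero (Finset.mem_univ j), mul_zero]
        simp [hj, hj0]
      · intro h
        simpa using h
    have := hf.comp hX
    simp only [Function.comp_def, hconst] at this
    exact not_tendsto_const_atTop _ _ this
  obtain ⟨α, hα, hmax⟩ := A.exists_max_image (fun α => α i) hA
  obtain ⟨hαs, h0, hs⟩ := Finset.mem_filter.1 hα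
  have hV : Finsupp.single i (α i) ∈ Vinf f := by
    refine single_mem_Vinf (Nat.pos_of_ne_zero h0) (hs ▸ hαs) fun k hk => ?_
    rcases Nat.eq_zero_or_pos k with rfl | hk0
    · exact Nat.zero_le _
    · simpa using hmax (Finsupp.single i k)
        (Finset.mem_filter.2 ⟨hk, by simpa using hk0.ne', by simp⟩)
  obtain ⟨k, hk⟩ := hf.condC1 _ hV i
  rw [Finsupp.single_eq_same] at hk
  refine ⟨k, by omega, ?_⟩
  rwa [two_mul, ← hk]

/-- The Newton polytope at infinity is spanned by the origin and the vertices at infinity. -/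
theorem newtonInfty_subset_convexHull {n : ℕ} (f : MvPolynomial (Fin n) ℝ) :
    newtonInfty f ⊆ convexHull ℝ (expEmbed '' (insert 0 (Vinf f : Set (Fin n →₀ ℕ)))) := by
  have hfin : (expEmbed '' ((insert 0 f.support : Finset (Fin n →₀ ℕ)) :
      Set (Fin n →₀ ℕ))).Finite := (Finset.finite_toSet _).image _
  have hext : Set.extremePoints ℝ (newtonInfty f) ⊆
      expEmbed '' (insert 0 (Vinf f : Set (Fin n →₀ ℕ))) := by
    intro x hx
    obtain ⟨α, hα, rfl⟩ := extremePoints_convexHull_subset hx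
    refine ⟨α, ?_, rfl⟩
    rcases eq_or_ne α 0 with rfl | h0
    · exact Set.mem_insert _ _
    · exact Set.mem_insert_of_mem _
        (mem_Vinf.2 ⟨h0, (Finset.mem_insert.1 (Finset.mem_coe.1 hα)).resolve_left h0, hx⟩)
  have hcl : IsClosed (convexHull ℝ (expEmbed '' (insert 0 (Vinf f : Set (Fin n →₀ ℕ))))) :=
    (((Vinf f).finite_toSet.insert 0).image _).isClosed_convexHull ℝ
  have hKM := closure_convexHull_extremePoints (s := newtonInfty f) (hfin.isCompact_convexHull ℝ)
    (convex_convexHull ℝ _)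
  rw [← hKM]
  exact closure_minimal (convexHull_mono hext) hcl

/-- A bound on generalized monomials at the generators extends to their convex hull. -/
theorem prod_rpow_le_of_mem_convexHull {n : ℕ} {x : Fin n → ℝ} (hx : ∀ i, 0 ≤ x i)
    {T : ℝ} (hT : 0 ≤ T) {s : Set (Fin n → ℝ)} (hs : ∀ u ∈ s, ∀ i, 0 ≤ u i)
    (h : ∀ u ∈ s, ∏ i, x i ^ u i ≤ T) {p : Fin n → ℝ} (hp : p ∈ convexHull ℝ s) :
    (∀ i, 0 ≤ p i) ∧ ∏ i, x i ^ p i ≤ T := by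
  have hconv : Convex ℝ {p : Fin n → ℝ | (∀ i, 0 ≤ p i) ∧ ∏ i, x i ^ p i ≤ T} := by
    rintro u ⟨hu, hu'⟩ v ⟨hv, hv'⟩ a b ha hb hab
    refine ⟨fun i => by simpa using add_nonneg (mul_nonneg ha (hu i)) (mul_nonneg hb (hv i)), ?_⟩
    have hprod : ∀ w : Fin n → ℝ, 0 ≤ ∏ i, x i ^ w i :=
      fun w => Finset.prod_nonneg fun i _ => Real.rpow_nonneg (hx i) _
    calc ∏ i, x i ^ (a • u + b • v) i = (∏ i, x i ^ u i) ^ a * (∏ i, x i ^ v i) ^ b := by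
          rw [← Real.finsetProd_rpow _ _ fun i _ => Real.rpow_nonneg (hx i) _,
            ← Real.finsetProd_rpow _ _ fun i _ => Real.rpow_nonneg (hx i) _,
            ← Finset.prod_mul_distrib]
          refine Finset.prod_congr rfl fun i _ => ?_
          rw [← Real.rpow_mul (hx i), ← Real.rpow_mul (hx i), ← Real.rpow_add_of_nonneg (hx i)
            (mul_nonneg (hu i) ha) (mul_nonneg (hv i) hb)]
          simp [mul_comm]
      _ ≤ T ^ a * T ^ b := by
          gcongr
          exacts [Real.rpow_nonneg (hprod v) _, hprod u, hprod v]
      _ = T := by rw [← Real.rpow_add_of_nonneg hT ha hb, hab, Real.rpow_one]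
  exact hconv.convexHull_subset_iff.2 (fun u hu => ⟨hs u hu, h u hu⟩) hp

/-- In the gem regular case, exponents that are no vertices at infinity are strict contractions
of points of the Newton polytope at infinity. -/
theorem GemRegular.exists_contraction {n : ℕ} {f : MvPolynomial (Fin n) ℝ} (hreg : GemRegular f)
    {β : Fin n →₀ ℕ} (hβ : β ∈ f.support) (hβV : β ∉ Vinf f) :
    ∃ s : ℝ, 0 ≤ s ∧ s < 1 ∧ ∃ p ∈ newtonInfty f, expEmbed β = s • p := by
  by_contra! h
  have hmem : ∀ α ∈ insert 0 f.support, expEmbed α ∈ newtonInfty f := fun α hα =>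
    subset_convexHull ℝ _ ⟨α, Finset.mem_coe.2 hα, rfl⟩
  have hβG : expEmbed β ∈
      {x ∈ newtonInfty f | ∀ s : ℝ, 0 ≤ s → s < 1 → ∀ p ∈ newtonInfty f, x ≠ s • p} :=
    ⟨hmem β (Finset.mem_insert_of_mem hβ), h⟩
  refine hreg β ⟨hβ, hβV, _, ⟨_, hβG⟩, isExtreme_not_mem_contraction (convex_convexHull ℝ _),
    fun h0 => ?_, hβG⟩
  exact h0.2 0 le_rfl one_pos _ h0.1 (by simp)

theorem abs_monomial_le {n : ℕ} {f : MvPolynomial (Fin n) ℝ} {x : Fin n → ℝ} {T : ℝ}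
    (hT : 1 ≤ T) (hV : ∀ v ∈ Vinf f, ∏ i, |x i| ^ v i ≤ T) {β : Fin n →₀ ℕ} {s : ℝ}
    (hs : 0 ≤ s) {p : Fin n → ℝ} (hp : p ∈ newtonInfty f) (hβ : expEmbed β = s • p) :
    |∏ i, x i ^ β i| ≤ T ^ s := by
  obtain ⟨hp0, hpT⟩ := prod_rpow_le_of_mem_convexHull (x := fun i => |x i|)
    (fun i => abs_nonneg _) (zero_le_one.trans hT)
    (by rintro _ ⟨α, _, rfl⟩ i; exact Nat.cast_nonneg _)
    (by
      rintro _ ⟨α, hα, rfl⟩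
      simp only [expEmbed, Real.rpow_natCast]
      rcases hα with rfl | hα
      · simpa using hT
      · exact hV α hα)
    (newtonInfty_subset_convexHull f hp)
  calc |∏ i, x i ^ β i| = (∏ i, |x i| ^ p i) ^ s := by
        rw [← Real.finsetProd_rpow _ _ fun i _ => Real.rpow_nonneg (abs_nonneg _) _,
          Finset.abs_prod]
        refine Finset.prod_congr rfl fun i _ => ?_
        have := congrFun hβ i
        simp only [expEmbed, Pi.smul_apply, smul_eq_mul] at this
        rw [← Real.rpow_mul (abs_nonneg _), mul_comm, ← this, Real.rpow_natCast, abs_pow]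
    _ ≤ T ^ s := Real.rpow_le_rpow
        (Finset.prod_nonneg fun i _ => Real.rpow_nonneg (abs_nonneg _) _) hpT hs

/-- A linear function dominates sublinear powers. -/
theorem tendsto_linear_sub_sum_rpow {ι : Type*} (B : Finset ι) (a s : ι → ℝ)
    (hs : ∀ β ∈ B, s β < 1) {c : ℝ} (hc : 0 < c) :
    Tendsto (fun T : ℝ => c * (T - 1) - ∑ β ∈ B, a β * T ^ s β) atTop atTop := by
  have hlim : Tendsto (fun T : ℝ => c * (1 - T⁻¹) - ∑ β ∈ B, a β * T ^ (-(1 - s β))) atTop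
      (nhds (c * (1 - 0) - ∑ β ∈ B, a β * 0)) := by
    refine ((tendsto_const_nhds.sub tendsto_inv_atTop_zero).const_mul c).sub
      (tendsto_finsetSum _ fun β hβ => ?_)
    exact (tendsto_rpow_neg_atTop (sub_pos.2 (hs β hβ))).const_mul _
  refine (tendsto_id.atTop_mul_pos (by simpa using hc) hlim).congr' ?_
  filter_upwards [eventually_gt_atTop 0] with T hT
  rw [id, mul_sub, Finset.mul_sum]
  congr 1
  · field_simp
  · refine Finset.sum_congr rfl fun β _ => ?_
    rw [neg_sub, Real.rpow_sub_one hT.ne']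
    field_simp

theorem GemRegular.coercive {n : ℕ} {f : MvPolynomial (Fin n) ℝ} (hreg : GemRegular f)
    (h1 : CondC1 f) (h2 : CondC2 f) (h3 : CondC3 f) :
    Coercive fun x => MvPolynomial.eval x f := by
  have hsub : Vinf f ⊆ f.support := fun v hv => (mem_Vinf.1 hv).2.1
  obtain ⟨c, hc0, hc⟩ : ∃ c : ℝ, 0 < c ∧ ∀ v ∈ Vinf f, c ≤ f.coeff v := by
    rcases (Vinf f).eq_empty_or_nonempty with he | hne
    · exact ⟨1, one_pos, by simp [he]⟩
    · obtain ⟨v, hv, hmin⟩ := (Vinf f).exists_min_image (fun v => f.coeff v) hne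
      exact ⟨_, h2 v hv, hmin⟩
  have hcontr : ∀ β : Fin n →₀ ℕ, ∃ s : ℝ, β ∈ f.support \ Vinf f →
      0 ≤ s ∧ s < 1 ∧ ∃ p ∈ newtonInfty f, expEmbed β = s • p := by
    intro β
    by_cases hβ : β ∈ f.support \ Vinf f
    · obtain ⟨s, hs⟩ := hreg.exists_contraction (Finset.mem_sdiff.1 hβ).1
        (Finset.mem_sdiff.1 hβ).2
      exact ⟨s, fun _ => hs⟩
    · exact ⟨0, fun h => absurd h hβ⟩
  choose s hs using hcontr
  let T : (Fin n → ℝ) → ℝ := fun x => 1 + ∑ v ∈ Vinf f, ∏ i, x i ^ v i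
  have hnn : ∀ (x : Fin n → ℝ), ∀ v ∈ Vinf f, 0 ≤ ∏ i, x i ^ v i := fun x v hv =>
    Finset.prod_nonneg fun i _ => (h1 v hv i).pow_nonneg _
  have hvT : ∀ x, ∀ v ∈ Vinf f, 1 + ∏ i, x i ^ v i ≤ T x := fun x v hv => by
    have := Finset.single_le_sum (f := fun v : Fin n →₀ ℕ => ∏ i, x i ^ v i) (hnn x) hv
    simpa [T] using this
  have hT1 : ∀ x, 1 ≤ T x := fun x => by
    simpa [T] using Finset.sum_nonneg (hnn x)
  have hTtop : Tendsto T (comap (fun x : Fin n → ℝ => ‖x‖) atTop) atTop := by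
    refine tendsto_atTop_mono (fun x => ?_) tendsto_comap
    refine (pi_norm_le_iff_of_nonneg (zero_le_one.trans (hT1 x))).2 fun i => ?_
    obtain ⟨k, hk, hkV⟩ := h3 i
    refine le_trans ?_ (hvT x _ hkV)
    rw [Finset.prod_eq_single i
      (fun j _ hj => by rw [Finsupp.single_eq_of_ne hj, pow_zero]) (by simp),
      Finsupp.single_eq_same, pow_mul, ← sq_abs, ← pow_mul, Real.norm_eq_abs]
    rcases le_total |x i| 1 with h | h
    · exact h.trans (le_add_of_nonneg_right (by positivity))
    · exact (le_self_pow₀ h (by omega)).trans (le_add_of_nonneg_left zero_le_one)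
  refine tendsto_atTop_mono (fun x => ?_)
    ((tendsto_linear_sub_sum_rpow (f.support \ Vinf f) (fun β => |f.coeff β|) s
      (fun β hβ => (hs β hβ).2.1) hc0).comp hTtop)
  rw [MvPolynomial.eval_eq', ← Finset.sum_sdiff hsub, add_comm, Function.comp, sub_eq_add_neg,
    ← Finset.sum_neg_distrib]
  refine add_le_add ?_ (Finset.sum_le_sum fun β hβ => ?_)
  · simp only [T, add_sub_cancel_left, Finset.mul_sum]
    exact Finset.sum_le_sum fun v hv => mul_le_mul_of_nonneg_right (hc v hv) (hnn x v hv)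
  · obtain ⟨hs0, -, p, hp, hβp⟩ := hs β hβ
    have hle := abs_monomial_le (hT1 x) (fun v hv => by
      have habs : ∏ i, |x i| ^ v i = ∏ i, x i ^ v i :=
        Finset.prod_congr rfl fun i _ => (h1 v hv i).pow_abs _
      rw [habs]
      linarith [hvT x v hv]) hs0 hp hβp
    refine neg_le_of_abs_le ?_
    rw [abs_mul]
    exact mul_le_mul_of_nonneg_left hle (abs_nonneg _)

/-- Theorem: characterization of coercivity for gem regular polynomials. -/
theorem stmt5 {n : ℕ} (f : MvPolynomial (Fin n) ℝ) (hreg : GemRegular f) :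
    (Coercive fun x => MvPolynomial.eval x f) ↔ (CondC1 f ∧ CondC2 f ∧ CondC3 f) := by
  exact ⟨fun hf => ⟨hf.condC1, hf.condC2, hf.condC3⟩, fun ⟨h1, h2, h3⟩ => hreg.coercive h1 h2 h3⟩

end
end
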